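/- Let k ≥ 2 be an integer and set v = ⌈log₂ k⌉. There exists a ReQU network of architecture (k, 2^{v+1}, 2^v, 2^{v−1}, …, 8, 4, 1) with v hidden layers (hidden widths 2^{v+1}, 2^v, …, 4), all weights in [−1,1], and at most 5·2^{2v} nonzero weights, which computes the map (x_1, …, x_k) ↦ x_1 x_2 ··· x_k for every x ∈ ℝ^k. -/

import Mathlib

open scoped BigOperators Classical

noncomputable def requ (t : ℝ) : ℝ := (max t 0) ^ 2

structure ReQUNet where
  L : ℕ
  arch : ℕ → ℕ
  W : ℕ → ℕ → ℕ → ℝ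
  v : ℕ → ℕ → ℝ

namespace ReQUNet

noncomputable def hidden (N : ReQUNet) (x : ℕ → ℝ) : ℕ → ℕ → ℝ
  | 0, j => ∑ k ∈ Finset.range (N.arch 0), N.W 0 j k * x k
  | i + 1, j =>
      ∑ k ∈ Finset.range (N.arch (i + 1)),
        N.W (i + 1) j k * requ (N.hidden x i k - N.v (i + 1) k)

noncomputable def eval (N : ReQUNet) (x : ℕ → ℝ) : ℕ → ℝ := N.hidden x N.L

noncomputable def evalVec (N : ReQUNet) (d : ℕ) (x : Fin d → ℝ) : ℕ → ℝ :=
  N.eval fun k => if h : k < d then x ⟨k, h⟩ else 0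

def width (N : ReQUNet) : ℕ := (Finset.range (N.L + 2)).sup N.arch

def weightsIn (N : ReQUNet) (s : Set ℝ) : Prop :=
  (∀ i ≤ N.L, ∀ j < N.arch (i + 1), ∀ k < N.arch i, N.W i j k ∈ s) ∧
  ∀ i, 1 ≤ i → i ≤ N.L → ∀ j < N.arch i, N.v i j ∈ s

noncomputable def numNonzero (N : ReQUNet) : ℕ :=
  (∑ i ∈ Finset.range (N.L + 1),
    ((Finset.range (N.arch (i + 1)) ×ˢ Finset.range (N.arch i)).filter
      fun p => N.W i p.1 p.2 ≠ 0).card) +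
  ∑ i ∈ Finset.Icc 1 N.L,
    ((Finset.range (N.arch i)).filter fun j => N.v i j ≠ 0).card

end ReQUNet

noncomputable def pderiv1 {d : ℕ} (i : Fin d) (g : (Fin d → ℝ) → ℝ) : (Fin d → ℝ) → ℝ :=
  fun x => fderiv ℝ g x (Pi.single i 1)

noncomputable def mderiv {d : ℕ} (γ : Fin d → ℕ) (g : (Fin d → ℝ) → ℝ) : (Fin d → ℝ) → ℝ :=
  (List.finRange d).foldr (fun i h => (pderiv1 i)^[γ i] h) g

noncomputable def eucDist {d : ℕ} (x y : Fin d → ℝ) : ℝ :=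
  Real.sqrt (∑ i, (x i - y i) ^ 2)

def cube (d : ℕ) : Set (Fin d → ℝ) := Set.Icc 0 1

def cubeHO (d : ℕ) : Set (Fin d → ℝ) := Set.Ico 0 1

def HolderNormLeOn {d : ℕ} (Ω : Set (Fin d → ℝ)) : ℕ → ((Fin d → ℝ) → ℝ) → ℝ → Prop
  | 0, g, E => ∀ x ∈ Ω, |g x| ≤ E
  | m + 1, g, E =>
      (∀ γ : Fin d → ℕ, (∑ i, γ i) ≤ m → ∀ x ∈ Ω, |mderiv γ g x| ≤ E) ∧
      ∀ γ : Fin d → ℕ, (∑ i, γ i) = m → ∀ x ∈ Ω, ∀ y ∈ Ω, x ≠ y →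
        |mderiv γ g x - mderiv γ g y| ≤ E * min 1 (eucDist x y)

def VHolderNormLe {d : ℕ} (p ℓ : ℕ) (f : (Fin d → ℝ) → Fin p → ℝ) (E : ℝ) : Prop :=
  ∀ i : Fin p, HolderNormLeOn (cube d) ℓ (fun x => f x i) E

noncomputable def lfloor (β : ℝ) : ℕ := ⌈β⌉₊ - 1

def MemHolderBall {d : ℕ} (p : ℕ) (β H : ℝ) (f : (Fin d → ℝ) → Fin p → ℝ) : Prop :=
  (∀ i : Fin p, ContDiff ℝ (lfloor β : ℕ∞) fun x => f x i) ∧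
  (∀ i : Fin p, ∀ γ : Fin d → ℕ, (∑ j, γ j) ≤ lfloor β →
      ∀ x ∈ cube d, |mderiv γ (fun y => f y i) x| ≤ H) ∧
  ∀ i : Fin p, ∀ γ : Fin d → ℕ, (∑ j, γ j) = lfloor β →
      ∀ x ∈ cube d, ∀ y ∈ cube d, x ≠ y →
        |mderiv γ (fun z => f z i) x - mderiv γ (fun z => f z i) y| ≤
          H * min 1 (eucDist x y) ^ (β - (lfloor β : ℝ))

def MemHolderBall1 {d : ℕ} (β H : ℝ) (f : (Fin d → ℝ) → ℝ) : Prop :=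
  (ContDiff ℝ (lfloor β : ℕ∞) f) ∧
  (∀ γ : Fin d → ℕ, (∑ j, γ j) ≤ lfloor β → ∀ x ∈ cube d, |mderiv γ f x| ≤ H) ∧
  ∀ γ : Fin d → ℕ, (∑ j, γ j) = lfloor β →
      ∀ x ∈ cube d, ∀ y ∈ cube d, x ≠ y →
        |mderiv γ f x - mderiv γ f y| ≤ H * min 1 (eucDist x y) ^ (β - (lfloor β : ℝ))

noncomputable def loglog2 (H : ℝ) : ℝ := if H ≤ 2 then 0 else Real.logb 2 (Real.logb 2 H)

noncomputable def knot (q K j : ℕ) : ℝ :=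
  if j ≤ q + 1 then 0 else if j ≤ q + K then ((j - (q + 1) : ℕ) : ℝ) / K else 1

noncomputable def Bspl (q K : ℕ) : ℕ → ℕ → ℝ → ℝ
  | 0, j, x =>
      if knot q K j < knot q K (j + 1) ∧ knot q K j ≤ x ∧ x < knot q K (j + 1) then
        1 / (knot q K (j + 1) - knot q K j)
      else 0
  | m + 1, j, x =>
      if knot q K j < knot q K (j + m + 2) ∧ knot q K j ≤ x ∧ x < knot q K (j + m + 2) then
        ((x - knot q K j) * Bspl q K m j x
            + (knot q K (j + m + 2) - x) * Bspl q K m (j + 1) x) /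
          (knot q K (j + m + 2) - knot q K j)
      else 0

noncomputable def Nspl (q K m j : ℕ) (x : ℝ) : ℝ :=
  (knot q K (j + m + 1) - knot q K j) * Bspl q K m j x

def QRanalytic {d : ℕ} (p : ℕ) (Q R : ℝ) (f : (Fin d → ℝ) → Fin p → ℝ) : Prop :=
  (∀ i : Fin p, ContDiff ℝ (⊤ : ℕ∞) fun x => f x i) ∧
  ∀ s : ℕ, VHolderNormLe p s f (Q * ((R : ℝ) ^ s)⁻¹ * (Nat.factorial s : ℝ))

def archSpec (q K i : ℕ) : ℕ :=
  if i = 0 then 1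
  else if i = 1 then 4 * (K + 2 * q - 1) + K
  else if i ≤ 4 then 4 * K + 8 * q
  else if i ≤ 4 + 2 * (q - 2) then
    (if (i - 5) % 2 = 0 then 12 * (K + 2 * q - (3 + (i - 5) / 2)) + 12
      else 8 * (K + 2 * q - (3 + (i - 5) / 2)) + 8)
  else K + q + 2

theorem requ_add_requ_neg (t : ℝ) : requ t + requ (-t) = t ^ 2 := by
  unfold requ
  rcases le_total t 0 with h | h
  · rw [max_eq_right h, max_eq_left (by linarith)]; ring
  · rw [max_eq_left h, max_eq_right (by linarith)]; ring

namespace ProductNet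

/-- Sign of the first factor in the `r`-th of the four units computing a product of two numbers. -/
noncomputable def sgnFst (r : ℕ) : ℝ := if r = 0 ∨ r = 2 then 1 else -1

/-- Sign of the second factor in the `r`-th of the four units computing a product. -/
noncomputable def sgnSnd (r : ℕ) : ℝ := if r = 0 ∨ r = 3 then 1 else -1

/-- Weight with which the `r`-th unit contributes to the product. -/
noncomputable def outCoeff (r : ℕ) : ℝ := if r = 0 ∨ r = 1 then 1 / 4 else -1 / 4

theorem sgnFst_mem (r : ℕ) : sgnFst r ∈ Set.Icc (-1 : ℝ) 1 := by
  unfold sgnFst; split_ifs <;> norm_num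

theorem sgnSnd_mem (r : ℕ) : sgnSnd r ∈ Set.Icc (-1 : ℝ) 1 := by
  unfold sgnSnd; split_ifs <;> norm_num

theorem outCoeff_mem (r : ℕ) : outCoeff r ∈ Set.Icc (-1 : ℝ) 1 := by
  unfold outCoeff; split_ifs <;> norm_num

theorem sum_outCoeff_mul_requ (a b : ℝ) :
    ∑ r ∈ Finset.range 4, outCoeff r * requ (sgnFst r * a + sgnSnd r * b) = a * b := by
  have h₁ := requ_add_requ_neg (a + b)
  have h₂ := requ_add_requ_neg (a - b)
  simp only [Finset.sum_range_succ, Finset.sum_range_zero, outCoeff, sgnFst, sgnSnd]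
  norm_num
  rw [show -a + -b = -(a + b) by ring, show -a + b = -(a - b) by ring,
    show a + -b = a - b by ring]
  linarith

/-- The vector with entry `a` at `p`, entry `b` at `q`, and zeros elsewhere. -/
noncomputable def pairVec (a b : ℝ) (p q m : ℕ) : ℝ := if m = p then a else if m = q then b else 0

theorem pairVec_mem {a b : ℝ} (ha : a ∈ Set.Icc (-1 : ℝ) 1) (hb : b ∈ Set.Icc (-1 : ℝ) 1)
    (p q m : ℕ) : pairVec a b p q m ∈ Set.Icc (-1 : ℝ) 1 := by
  unfold pairVec; split_ifs
  exacts [ha, hb, by norm_num]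

theorem sum_pairVec_mul (a b : ℝ) {p q n : ℕ} (hpq : p ≠ q) (hp : p < n) (f : ℕ → ℝ) :
    ∑ m ∈ Finset.range n, pairVec a b p q m * f m = a * f p + if q < n then b * f q else 0 := by
  have h : ∀ m, pairVec a b p q m * f m =
      (if m = p then a * f m else 0) + if m = q then b * f m else 0 := by
    intro m
    unfold pairVec
    split_ifs with h₁ h₂ <;> simp_all
  simp only [h, Finset.sum_add_distrib, Finset.sum_ite_eq', Finset.mem_range, if_pos hp]

theorem sum_range_four_mul (n : ℕ) (f : ℕ → ℝ) :
    ∑ j ∈ Finset.range (4 * n), f j =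
      ∑ m ∈ Finset.range n, ∑ r ∈ Finset.range 4, f (4 * m + r) := by
  induction n with
  | zero => simp
  | succ n ih => rw [Nat.mul_succ, Finset.sum_range_add, ih, Finset.sum_range_succ _ n]

/-- The widths of the product network with `k` inputs and `v` hidden layers. -/
def arch (k v i : ℕ) : ℕ := if i = 0 then k else if i ≤ v then 2 ^ (v + 2 - i) else 1

/-- The network multiplying `k` numbers by repeatedly multiplying the first half of the current
factors with the second half; missing inputs are replaced by `1` through the first bias vector. -/
noncomputable def net (k v : ℕ) : ReQUNet where
  L := v
  arch := arch k v
  W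
    | 0, j, m => pairVec (sgnFst (j % 4)) (sgnSnd (j % 4)) (j / 4) (j / 4 + 2 ^ (v - 1)) m
    | i + 1, j, m =>
      outCoeff (m % 4) *
        pairVec (sgnFst (j % 4)) (sgnSnd (j % 4)) (j / 4) (j / 4 + 2 ^ (v - 1 - (i + 1))) (m / 4)
  v i j := if i = 1 ∧ k ≤ j / 4 + 2 ^ (v - 1) then -sgnSnd (j % 4) else 0

theorem net_weightsIn (k v : ℕ) : (net k v).weightsIn (Set.Icc (-1) 1) := by
  refine ⟨fun i _ j _ m _ => ?_, fun i _ _ j _ => ?_⟩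
  · cases i with
    | zero => exact pairVec_mem (sgnFst_mem _) (sgnSnd_mem _) _ _ _
    | succ i =>
      rw [Set.mem_Icc, ← abs_le]
      simp only [net, abs_mul]
      exact mul_le_one₀ (abs_le.2 (outCoeff_mem _)) (abs_nonneg _)
        (abs_le.2 (pairVec_mem (sgnFst_mem _) (sgnSnd_mem _) _ _ _))
  · have h := sgnSnd_mem (j % 4)
    simp only [net, Set.mem_Icc] at h ⊢
    split_ifs
    · constructor <;> linarith
    · norm_num

/-- The partial products held by the network: at level `i + 1`, the `m`-th partial product is that
of the `m`-th ones from both halves at level `i`. -/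
noncomputable def partialProd (k v : ℕ) (x : ℕ → ℝ) : ℕ → ℕ → ℝ
  | 0, m => if m < k then x m else 1
  | i + 1, m => partialProd k v x i m * partialProd k v x i (m + 2 ^ (v - 1 - i))

theorem prod_partialProd {k v : ℕ} (x : ℕ → ℝ) (hk : k ≤ 2 ^ v) {i : ℕ} (hi : i ≤ v) :
    ∏ m ∈ Finset.range (2 ^ (v - i)), partialProd k v x i m = ∏ m ∈ Finset.range k, x m := by
  induction i with
  | zero =>
    obtain ⟨d, hd⟩ := Nat.exists_eq_add_of_le hk
    simp only [partialProd, Nat.sub_zero]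
    rw [hd, Finset.prod_range_add]
    simp only [add_lt_iff_neg_left, not_lt_zero, if_false, Finset.prod_const_one, mul_one]
    exact Finset.prod_congr rfl fun m hm => if_pos (Finset.mem_range.1 hm)
  | succ i ih =>
    rw [← ih (by omega), show v - i = v - (i + 1) + 1 by omega, pow_succ, mul_two,
      Finset.prod_range_add, ← Finset.prod_mul_distrib]
    refine Finset.prod_congr rfl fun m _ => ?_
    rw [partialProd, show v - 1 - i = v - (i + 1) by omega, add_comm m]

theorem hidden_net_succ {k v : ℕ} (x : ℕ → ℝ) {i : ℕ} (hi : i < v)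
    (h : ∀ j, j / 4 < 2 ^ (v - 1 - i) →
      (net k v).hidden x i j - (net k v).v (i + 1) j =
        sgnFst (j % 4) * partialProd k v x i (j / 4) +
          sgnSnd (j % 4) * partialProd k v x i (j / 4 + 2 ^ (v - 1 - i))) (j : ℕ) :
    (net k v).hidden x (i + 1) j =
      ∑ m ∈ Finset.range (2 ^ (v - 1 - i)),
        pairVec (sgnFst (j % 4)) (sgnSnd (j % 4)) (j / 4) (j / 4 + 2 ^ (v - 1 - (i + 1))) m *
          partialProd k v x (i + 1) m := by
  have harch : (net k v).arch (i + 1) = 4 * 2 ^ (v - 1 - i) := by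
    simp only [net, arch]
    rw [if_neg i.succ_ne_zero, if_pos (by omega), show v + 2 - (i + 1) = v - 1 - i + 2 by omega]
    ring
  rw [ReQUNet.hidden, harch, sum_range_four_mul]
  refine Finset.sum_congr rfl fun m hm => ?_
  rw [Finset.mem_range] at hm
  rw [partialProd,
    ← sum_outCoeff_mul_requ (partialProd k v x i m) (partialProd k v x i (m + 2 ^ (v - 1 - i))),
    Finset.mul_sum]
  refine Finset.sum_congr rfl fun r hr => ?_
  rw [Finset.mem_range] at hr
  have hdiv : (4 * m + r) / 4 = m := by omega
  have hmod : (4 * m + r) % 4 = r := by omega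
  rw [h _ (by rwa [hdiv])]
  simp only [net, hdiv, hmod]
  ring

theorem hidden_net_sub_bias {k v : ℕ} (x : ℕ → ℝ) (hk : 2 ^ (v - 1) < k) {i : ℕ} (hi : i < v)
    {j : ℕ} (hj : j / 4 < 2 ^ (v - 1 - i)) :
    (net k v).hidden x i j - (net k v).v (i + 1) j =
      sgnFst (j % 4) * partialProd k v x i (j / 4) +
        sgnSnd (j % 4) * partialProd k v x i (j / 4 + 2 ^ (v - 1 - i)) := by
  induction i generalizing j with
  | zero =>
    have hpos : 0 < 2 ^ (v - 1) := by positivity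
    rw [Nat.sub_zero] at hj
    have hlt : j / 4 < k := hj.trans hk
    simp only [ReQUNet.hidden, net, arch, if_true, partialProd, Nat.sub_zero, zero_add, true_and]
    rw [sum_pairVec_mul _ _ (Nat.lt_add_of_pos_right hpos).ne hlt, if_pos hlt]
    by_cases h : j / 4 + 2 ^ (v - 1) < k
    · simp [h]
    · simp [h, not_lt.1 h]
  | succ i ih =>
    have hpos : 0 < 2 ^ (v - 1 - (i + 1)) := by positivity
    have htwo : 2 ^ (v - 1 - i) = 2 ^ (v - 1 - (i + 1)) + 2 ^ (v - 1 - (i + 1)) := by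
      rw [← mul_two, ← pow_succ]
      congr 1
      omega
    rw [hidden_net_succ x (by omega) (fun j hj => ih (by omega) hj),
      sum_pairVec_mul _ _ (Nat.lt_add_of_pos_right hpos).ne (by omega), if_pos (by omega)]
    simp [net]

theorem hidden_net_last {k v : ℕ} (x : ℕ → ℝ) (hv : 0 < v) (hk : 2 ^ (v - 1) < k)
    (hkv : k ≤ 2 ^ v) : (net k v).hidden x v 0 = ∏ m ∈ Finset.range k, x m := by
  obtain ⟨w, rfl⟩ := Nat.exists_eq_add_one.2 hv
  rw [← prod_partialProd x hkv le_rfl,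
    hidden_net_succ x w.lt_succ_self fun j hj => hidden_net_sub_bias x hk w.lt_succ_self hj]
  simp [pairVec, sgnFst]

theorem three_mul_sum_two_pow_mul (w : ℕ) :
    3 * ∑ i ∈ Finset.range w, 2 ^ (w + 1 - i) * 2 ^ (w + 2 - i) + 32 = 32 * (2 ^ w * 2 ^ w) := by
  induction w with
  | zero => simp
  | succ w ih =>
    rw [Finset.sum_range_succ']
    have h₁ : ∀ i, w + 1 + 1 - (i + 1) = w + 1 - i := by omega
    have h₂ : ∀ i, w + 1 + 2 - (i + 1) = w + 2 - i := by omega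
    simp only [h₁, h₂, Nat.sub_zero]
    ring_nf at ih ⊢
    omega

theorem sum_two_pow_sub (w : ℕ) :
    ∑ i ∈ Finset.range w, 2 ^ (w + 2 - i) + 8 = 8 * 2 ^ w := by
  induction w with
  | zero => simp
  | succ w ih =>
    rw [Finset.sum_range_succ']
    have h : ∀ i, w + 1 + 2 - (i + 1) = w + 2 - i := by omega
    simp only [h, Nat.sub_zero]
    ring_nf at ih ⊢
    omega

/-- A network has at most as many nonzero weights as it has weights. -/
theorem _root_.ReQUNet.numNonzero_le (N : ReQUNet) :
    N.numNonzero ≤ ∑ i ∈ Finset.range (N.L + 1), N.arch (i + 1) * N.arch i +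
      ∑ i ∈ Finset.range N.L, N.arch (i + 1) := by
  refine Nat.add_le_add (Finset.sum_le_sum fun i _ => ?_) ?_
  · refine (Finset.card_filter_le _ _).trans_eq ?_
    rw [Finset.card_product, Finset.card_range, Finset.card_range]
  · have hIcc : Finset.Icc 1 N.L = Finset.Ico (0 + 1) (N.L + 1) := by
      ext i
      simp only [Finset.mem_Icc, Finset.mem_Ico]
      omega
    rw [hIcc, Finset.range_eq_Ico, Finset.sum_Ico_add' N.arch 0 N.L 1]
    refine Finset.sum_le_sum fun i _ => (Finset.card_filter_le _ _).trans_eq ?_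
    rw [Finset.card_range]

theorem net_numNonzero_le {k v : ℕ} (hv : 0 < v) (hkv : k ≤ 2 ^ v) :
    (net k v).numNonzero ≤ 5 * 2 ^ (2 * v) := by
  obtain ⟨w, rfl⟩ := Nat.exists_eq_add_one.2 hv
  refine (ReQUNet.numNonzero_le _).trans ?_
  have harch : ∀ i ≤ w, arch k (w + 1) (i + 1) = 2 ^ (w + 2 - i) := by
    intro i hi
    rw [arch, if_neg i.succ_ne_zero, if_pos (by omega)]
    congr 1
    omega
  have hzero : arch k (w + 1) 0 = k := rfl
  have hlast : arch k (w + 1) (w + 1 + 1) = 1 := by simp [arch]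
  have hmid : ∑ i ∈ Finset.range w, arch k (w + 1) (i + 1 + 1) * arch k (w + 1) (i + 1) =
      ∑ i ∈ Finset.range w, 2 ^ (w + 1 - i) * 2 ^ (w + 2 - i) := by
    refine Finset.sum_congr rfl fun i hi => ?_
    rw [Finset.mem_range] at hi
    rw [harch i hi.le, harch (i + 1) hi]
    congr 2
    omega
  have hbias : ∑ i ∈ Finset.range w, arch k (w + 1) (i + 1) =
      ∑ i ∈ Finset.range w, 2 ^ (w + 2 - i) :=
    Finset.sum_congr rfl fun i hi => harch i (Finset.mem_range.1 hi).le
  have hw : w + 2 - w = 2 := by omega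
  simp only [net]
  rw [Finset.sum_range_succ, Finset.sum_range_succ', Finset.sum_range_succ _ w, hlast, hzero,
    hmid, hbias, harch 0 w.zero_le, harch w le_rfl, hw, Nat.sub_zero]
  have h₁ := three_mul_sum_two_pow_mul w
  have h₂ := sum_two_pow_sub w
  have h₃ : 2 ^ (w + 2) * k ≤ 8 * (2 ^ w * 2 ^ w) :=
    (Nat.mul_le_mul_left _ hkv).trans_eq (by ring)
  have h₄ : 6 * 2 ^ w ≤ 2 ^ w * 2 ^ w + 8 := by
    rcases w with _ | _ | w
    · norm_num
    · norm_num
    · have : 1 ≤ 2 ^ w := Nat.one_le_two_pow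
      rw [pow_succ, pow_succ]
      nlinarith
  rw [show 5 * 2 ^ (2 * (w + 1)) = 20 * (2 ^ w * 2 ^ w) by ring]
  omega

end ProductNet

theorem statement4 (k : ℕ) (hk : 2 ≤ k) :
    ∃ N : ReQUNet,
      N.L = Nat.clog 2 k ∧
      (∀ i ≤ N.L + 1, N.arch i =
        if i = 0 then k
        else if i ≤ Nat.clog 2 k then 2 ^ (Nat.clog 2 k + 2 - i)
        else 1) ∧
      N.weightsIn (Set.Icc (-1) 1) ∧
      N.numNonzero ≤ 5 * 2 ^ (2 * Nat.clog 2 k) ∧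
      ∀ x : Fin k → ℝ, N.evalVec k x 0 = ∏ i, x i := by
  have hv : 0 < Nat.clog 2 k := Nat.clog_pos one_lt_two hk
  have hkv : k ≤ 2 ^ Nat.clog 2 k := Nat.le_pow_clog one_lt_two k
  have hvk : 2 ^ (Nat.clog 2 k - 1) < k := Nat.pow_pred_clog_lt_self one_lt_two hk
  refine ⟨ProductNet.net k (Nat.clog 2 k), rfl, fun i _ => rfl, ProductNet.net_weightsIn _ _,
    ProductNet.net_numNonzero_le hv hkv, fun x => ?_⟩
  refine (ProductNet.hidden_net_last _ hv hvk hkv).trans ?_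
  rw [← Fin.prod_univ_eq_prod_range]
  simp
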